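/- Let N be a norm on ℝ^n and λ ≥ 0 a real number, and let N_λ = e^{−λ}·N (so that B(N_λ) = {x ∈ ℝ^n : N(x) ≤ e^{λ}}). Then 0 ≤ ĥ⁰(N_λ) − ĥ⁰(N) ≤ λ·n + n·log 9 + 2·log(n!). -/

import Mathlib

open MeasureTheory

/-- `N` is a norm on `ℝ^n`. -/
def IsNorm (n : ℕ) (N : (Fin n → ℝ) → ℝ) : Prop :=
  (∀ x, N x = 0 ↔ x = 0) ∧ (∀ (c : ℝ) (x), N (c • x) = |c| * N x) ∧
    (∀ x y, N (x + y) ≤ N x + N y)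

/-- `ĥ⁰(N) = log #(ℤ^n ∩ B(N))`. -/
noncomputable def h0Hat (n : ℕ) (N : (Fin n → ℝ) → ℝ) : ℝ :=
  Real.log (Nat.card {x : Fin n → ℤ // N (fun i => (x i : ℝ)) ≤ 1})

namespace IsNorm

variable {n : ℕ} {N : (Fin n → ℝ) → ℝ}

theorem map_zero (hN : IsNorm n N) : N 0 = 0 := (hN.1 0).2 rfl

theorem map_smul (hN : IsNorm n N) (c : ℝ) (x : Fin n → ℝ) : N (c • x) = |c| * N x := hN.2.1 c x

theorem map_neg (hN : IsNorm n N) (x : Fin n → ℝ) : N (-x) = N x := by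
  simpa using hN.map_smul (-1) x

theorem map_sub_le (hN : IsNorm n N) (x y : Fin n → ℝ) : N (x - y) ≤ N x + N y := by
  simpa [sub_eq_add_neg, hN.map_neg] using hN.2.2 x (-y)

theorem nonneg (hN : IsNorm n N) (x : Fin n → ℝ) : 0 ≤ N x := by
  have h := hN.map_sub_le x x
  rw [sub_self, hN.map_zero] at h
  linarith

theorem exists_le_mul_norm (hN : IsNorm n N) : ∃ C, 0 < C ∧ ∀ x, N x ≤ C * ‖x‖ := by
  have hsum : ∀ (s : Finset (Fin n)) (f : Fin n → Fin n → ℝ), N (∑ i ∈ s, f i) ≤ ∑ i ∈ s, N (f i) :=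
    fun s f => Finset.le_sum_of_subadditive N hN.map_zero.le hN.2.2 s f
  have hnn : 0 ≤ ∑ i, N (Pi.single i 1) := Finset.sum_nonneg fun i _ => hN.nonneg _
  refine ⟨∑ i, N (Pi.single i 1) + 1, by positivity, fun x => ?_⟩
  calc N x = N (∑ i, x i • Pi.single i (1 : ℝ)) := by
        rw [← pi_eq_sum_univ' x]
    _ ≤ ∑ i, N (x i • Pi.single i (1 : ℝ)) := hsum _ _
    _ ≤ ∑ i, ‖x‖ * N (Pi.single i 1) := by
        refine Finset.sum_le_sum fun i _ => ?_
        rw [hN.map_smul]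
        exact mul_le_mul_of_nonneg_right (norm_le_pi_norm x i) (hN.nonneg _)
    _ ≤ (∑ i, N (Pi.single i 1) + 1) * ‖x‖ := by
        rw [← Finset.mul_sum]
        nlinarith [norm_nonneg x]

theorem continuous (hN : IsNorm n N) : Continuous N := by
  obtain ⟨C, hC, h⟩ := hN.exists_le_mul_norm
  refine (LipschitzWith.of_le_add_mul ⟨C, hC.le⟩ fun x y => ?_).continuous
  have h1 := hN.2.2 y (x - y)
  have h2 := h (x - y)
  rw [add_sub_cancel] at h1
  rw [dist_eq_norm]
  exact h1.trans (by gcongr; exact h2)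

theorem exists_mul_norm_le (hN : IsNorm n N) : ∃ c, 0 < c ∧ ∀ x, c * ‖x‖ ≤ N x := by
  rcases (Metric.sphere (0 : Fin n → ℝ) 1).eq_empty_or_nonempty with he | hne
  · refine ⟨1, one_pos, fun x => ?_⟩
    have hx : x = 0 := by
      by_contra hx
      have : ‖x‖⁻¹ • x ∈ Metric.sphere (0 : Fin n → ℝ) 1 := by
        simp [norm_smul, inv_mul_cancel₀ (norm_ne_zero_iff.2 hx)]
      simp [he] at this
    simp [hx, hN.map_zero]
  · obtain ⟨u, hu, hmin⟩ := (isCompact_sphere (0 : Fin n → ℝ) 1).exists_isMinOn hne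
      hN.continuous.continuousOn
    have hu0 : u ≠ 0 := by
      rintro rfl
      simp at hu
    refine ⟨N u, (hN.nonneg u).lt_of_ne fun h => hu0 ((hN.1 u).1 h.symm), fun x => ?_⟩
    rcases eq_or_ne x 0 with rfl | hx
    · simp [hN.map_zero]
    have hx' : 0 < ‖x‖ := norm_pos_iff.2 hx
    have hmem : ‖x‖⁻¹ • x ∈ Metric.sphere (0 : Fin n → ℝ) 1 := by
      simp [norm_smul, inv_mul_cancel₀ hx'.ne']
    have h : N u ≤ N (‖x‖⁻¹ • x) := hmin hmem
    rw [hN.map_smul, abs_of_pos (inv_pos.2 hx'), inv_mul_eq_div, le_div_iff₀ hx'] at h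
    exact h

theorem isClosed_sublevel (hN : IsNorm n N) (ρ : ℝ) : IsClosed {x | N x ≤ ρ} :=
  isClosed_le hN.continuous continuous_const

theorem isBounded_sublevel (hN : IsNorm n N) (ρ : ℝ) : Bornology.IsBounded {x | N x ≤ ρ} := by
  obtain ⟨c, hc, h⟩ := hN.exists_mul_norm_le
  refine (Metric.isBounded_closedBall (x := (0 : Fin n → ℝ)) (r := ρ / c)).subset fun x hx => ?_
  rw [mem_closedBall_zero_iff, le_div_iff₀ hc, mul_comm]
  exact (h x).trans hx

theorem volume_sublevel_pos (hN : IsNorm n N) : 0 < volume {x | N x ≤ 1} := by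
  have hopen : IsOpen {x | N x < 1} := isOpen_lt hN.continuous continuous_const
  refine (hopen.measure_pos volume ⟨0, ?_⟩).trans_le (measure_mono fun x (hx : N x < 1) => hx.le)
  simp [hN.map_zero]

open scoped Pointwise in
theorem volume_sublevel (hN : IsNorm n N) {ρ : ℝ} (hρ : 0 < ρ) :
    volume {x | N x ≤ ρ} = ENNReal.ofReal (ρ ^ n) * volume {x | N x ≤ 1} := by
  have h : {x | N x ≤ ρ} = ρ • {x | N x ≤ 1} := by
    ext x
    rw [Set.mem_smul_set_iff_inv_smul_mem₀ hρ.ne']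
    simp only [Set.mem_ofPred_eq]
    rw [hN.map_smul, abs_of_pos (inv_pos.2 hρ), inv_mul_le_iff₀ hρ, mul_one]
  rw [h, Measure.addHaar_smul, Module.finrank_fin_fun, abs_of_pos (pow_pos hρ n)]

/-- There are finitely many integer points in a ball of a norm. -/
theorem finite_lattice_sublevel (hN : IsNorm n N) (ρ : ℝ) :
    {x : Fin n → ℤ | N (fun i => (x i : ℝ)) ≤ ρ}.Finite := by
  obtain ⟨c, hc, h⟩ := hN.exists_mul_norm_le
  refine (isCompact_closedBall (0 : Fin n → ℤ) (ρ / c)).finite_of_discrete.subset fun x hx => ?_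
  rw [mem_closedBall_zero_iff, le_div_iff₀ hc, mul_comm]
  refine le_trans ?_ ((h _).trans hx)
  gcongr
  refine (pi_norm_le_iff_of_nonneg (norm_nonneg _)).2 fun i => ?_
  simpa only [Int.norm_eq_abs, Real.norm_eq_abs] using norm_le_pi_norm (fun i => (x i : ℝ)) i

/-- Averaging over translates: the number of integer points in the ball of radius `r` is at most
`(2r + 1)^n` times the number in the unit ball. -/
theorem card_lattice_le (hN : IsNorm n N) {r : ℝ} (hr : 0 < r) :
    (Nat.card {x : Fin n → ℤ // N (fun i => (x i : ℝ)) ≤ r} : ℝ) ≤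
      (2 * r + 1) ^ n * Nat.card {x : Fin n → ℤ // N (fun i => (x i : ℝ)) ≤ 1} := by
  classical
  set S := (hN.finite_lattice_sublevel r).toFinset with hS
  set L := (hN.finite_lattice_sublevel 1).toFinset with hL
  have hScard : Nat.card {x : Fin n → ℤ // N (fun i => (x i : ℝ)) ≤ r} = S.card :=
    Nat.card_eq_card_finite_toFinset (hN.finite_lattice_sublevel r)
  have hLcard : Nat.card {x : Fin n → ℤ // N (fun i => (x i : ℝ)) ≤ 1} = L.card :=
    Nat.card_eq_card_finite_toFinset (hN.finite_lattice_sublevel 1)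
  rw [hScard, hLcard]
  let B : (Fin n → ℤ) → Set (Fin n → ℝ) := fun x => {y | N (y - fun i => (x i : ℝ)) ≤ 1 / 2}
  have hBmeas : ∀ x, MeasurableSet (B x) := fun x =>
    ((hN.isClosed_sublevel (1 / 2)).preimage (continuous_sub_right _)).measurableSet
  have hBvol : ∀ x, volume (B x) = volume {y | N y ≤ 1 / 2} := fun x =>
    (measurePreserving_sub_right volume _).measure_preimage
      (hN.isClosed_sublevel (1 / 2)).measurableSet.nullMeasurableSet
  have hpt : ∀ y, ∑ x ∈ S, (B x).indicator (1 : (Fin n → ℝ) → ENNReal) y ≤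
      {y | N y ≤ r + 1 / 2}.indicator (fun _ => (L.card : ENNReal)) y := by
    intro y
    have hsum : ∑ x ∈ S, (B x).indicator (1 : (Fin n → ℝ) → ENNReal) y =
        ((S.filter fun x => y ∈ B x).card : ENNReal) := by
      simp [Set.indicator_apply]
    rw [hsum]
    rcases (S.filter fun x => y ∈ B x).eq_empty_or_nonempty with he | ⟨x₀, hx₀⟩
    · simp [he]
    obtain ⟨hx₀S, hx₀B⟩ := Finset.mem_filter.1 hx₀
    have hyr : N y ≤ r + 1 / 2 := by
      have h1 : N (fun i => (x₀ i : ℝ)) ≤ r := by simpa [hS] using hx₀S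
      have h2 := hN.2.2 (fun i => (x₀ i : ℝ)) (y - fun i => (x₀ i : ℝ))
      rw [add_sub_cancel] at h2
      exact h2.trans (add_le_add h1 hx₀B)
    rw [Set.indicator_of_mem (show y ∈ {y | N y ≤ r + 1 / 2} from hyr)]
    refine Nat.cast_le.2 (Finset.card_le_card_of_injOn (fun x => x - x₀) (fun x hx => ?_)
      fun a _ b _ h => sub_left_injective h)
    have hxB : N (y - fun i => (x i : ℝ)) ≤ 1 / 2 := (Finset.mem_filter.1 hx).2
    have heq : (fun i => ((x - x₀) i : ℝ)) =
        (y - fun i => (x₀ i : ℝ)) - (y - fun i => (x i : ℝ)) := by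
      ext i
      simp
    have h := hN.map_sub_le (y - fun i => (x₀ i : ℝ)) (y - fun i => (x i : ℝ))
    have hx₀B' : N (y - fun i => (x₀ i : ℝ)) ≤ 1 / 2 := hx₀B
    simp only [hL, Set.Finite.coe_toFinset, Set.mem_ofPred_eq]
    rw [heq]
    linarith
  have hint := lintegral_mono (μ := volume) hpt
  rw [lintegral_finsetSum _ fun x _ => measurable_one.indicator (hBmeas x),
    lintegral_indicator_const (hN.isClosed_sublevel _).measurableSet] at hint
  simp only [lintegral_indicator_one (hBmeas _), hBvol, Finset.sum_const, nsmul_eq_mul] at hint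
  rw [hN.volume_sublevel (ρ := 1 / 2) (by norm_num),
    hN.volume_sublevel (ρ := r + 1 / 2) (by positivity), ← mul_assoc,
    ← mul_assoc, ENNReal.mul_le_mul_iff_left hN.volume_sublevel_pos.ne'
      (hN.isBounded_sublevel 1).measure_lt_top.ne, ← ENNReal.ofReal_natCast,
    ← ENNReal.ofReal_natCast, ← ENNReal.ofReal_mul (by positivity),
    ← ENNReal.ofReal_mul (by positivity), ENNReal.ofReal_le_ofReal_iff (by positivity)] at hint
  have hpow : (2 * r + 1) ^ n = (2 : ℝ) ^ n * (r + 1 / 2) ^ n := by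
    rw [← mul_pow]
    congr 1
    ring
  have hhalf : (2 : ℝ) ^ n * (1 / 2) ^ n = 1 := by
    rw [← mul_pow]
    norm_num
  calc (S.card : ℝ) = 2 ^ n * (S.card * (1 / 2) ^ n) := by linear_combination (-S.card : ℝ) * hhalf
    _ ≤ 2 ^ n * (L.card * (r + 1 / 2) ^ n) := by gcongr
    _ = (2 * r + 1) ^ n * L.card := by rw [hpow]; ring

end IsNorm

/-- For a norm `N` on `ℝ^n` and `λ ≥ 0`, with `N_λ = e^{−λ}·N`:
`0 ≤ ĥ⁰(N_λ) − ĥ⁰(N) ≤ λ·n + n·log 9 + 2·log(n!)`. -/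
theorem stmt4 (n : ℕ) (hn : 1 ≤ n) (N : (Fin n → ℝ) → ℝ) (hN : IsNorm n N)
    (lam : ℝ) (hlam : 0 ≤ lam) :
    0 ≤ h0Hat n (fun x => Real.exp (-lam) * N x) - h0Hat n N ∧
      h0Hat n (fun x => Real.exp (-lam) * N x) - h0Hat n N ≤
        lam * n + (n : ℝ) * Real.log 9 + 2 * Real.log (n.factorial) := by
  have hexp : ∀ t : ℝ, Real.exp (-lam) * t ≤ 1 ↔ t ≤ Real.exp lam := fun t => by
    rw [Real.exp_neg, inv_mul_le_iff₀ (Real.exp_pos _), mul_one]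
  have hr : 1 ≤ Real.exp lam := Real.one_le_exp hlam
  have hfin := hN.finite_lattice_sublevel (Real.exp lam)
  unfold h0Hat
  simp only [hexp]
  have hle : Nat.card {x : Fin n → ℤ // N (fun i => (x i : ℝ)) ≤ 1} ≤
      Nat.card {x : Fin n → ℤ // N (fun i => (x i : ℝ)) ≤ Real.exp lam} :=
    Nat.card_mono hfin fun x (hx : N (fun i => (x i : ℝ)) ≤ 1) => hx.trans hr
  have hpos : 0 < Nat.card {x : Fin n → ℤ // N (fun i => (x i : ℝ)) ≤ 1} := by
    have : Finite {x : Fin n → ℤ // N (fun i => (x i : ℝ)) ≤ 1} := hN.finite_lattice_sublevel 1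
    have : Nonempty {x : Fin n → ℤ // N (fun i => (x i : ℝ)) ≤ 1} :=
      ⟨0, by
        have h0 : (fun i => (((0 : Fin n → ℤ) i : ℤ) : ℝ)) = 0 := by
          ext i
          simp
        rw [h0, hN.map_zero]
        exact zero_le_one⟩
    exact Nat.card_pos
  have hcard := hN.card_lattice_le (Real.exp_pos lam)
  set a := Nat.card {x : Fin n → ℤ // N (fun i => (x i : ℝ)) ≤ 1}
  set b := Nat.card {x : Fin n → ℤ // N (fun i => (x i : ℝ)) ≤ Real.exp lam}
  have ha : (0 : ℝ) < a := Nat.cast_pos.2 hpos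
  have hab : (a : ℝ) ≤ b := Nat.cast_le.2 hle
  refine ⟨sub_nonneg.2 (Real.log_le_log ha hab), ?_⟩
  have hbound : (b : ℝ) ≤ (Real.exp lam * 9) ^ n * a :=
    hcard.trans (by gcongr; linarith)
  have hlog := Real.log_le_log (ha.trans_le hab) hbound
  rw [Real.log_mul (by positivity) ha.ne', Real.log_pow,
    Real.log_mul (Real.exp_pos _).ne' (by norm_num), Real.log_exp] at hlog
  have hfact : 0 ≤ Real.log n.factorial := Real.log_natCast_nonneg _
  linarith
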